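/- For any edge e of H, every monomorphism φ : V(H \ {e}) → V(H) is the identity, where H \ {e} has the same vertex set as H and edge set E(H) \ {e}. -/

import Mathlib

open Finset

/-- Edge r = {z, v1, v3, v5, v8} (z is vertex 0, vᵢ is vertex i). -/
def er : Finset (Fin 10) := {0, 1, 3, 5, 8}
/-- Edge g = {z, v2, v4, v7, v9}. -/
def eg : Finset (Fin 10) := {0, 2, 4, 7, 9}
/-- Edge a = {v1, v4, v6, v8, v9}. -/
def ea : Finset (Fin 10) := {1, 4, 6, 8, 9}
/-- Edge b = {v9, v1, v2, v3, v4}. -/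
def eb : Finset (Fin 10) := {9, 1, 2, 3, 4}
def ee1 : Finset (Fin 10) := {1, 2, 3, 4, 5}
def ee2 : Finset (Fin 10) := {2, 3, 4, 5, 6}
def ee3 : Finset (Fin 10) := {3, 4, 5, 6, 7}
def ee4 : Finset (Fin 10) := {4, 5, 6, 7, 8}
def ee5 : Finset (Fin 10) := {5, 6, 7, 8, 9}

/-- The edge set of the 5-uniform hypergraph H. -/
def Hedges : Finset (Finset (Fin 10)) := {er, eg, ea, eb, ee1, ee2, ee3, ee4, ee5}

/-- Degree of a vertex with respect to an edge set. -/
def deg (E : Finset (Finset (Fin 10))) (x : Fin 10) : ℕ :=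
  (E.filter (fun s => x ∈ s)).card

/-- The edges of H as a list. -/
def edgeList : List (Finset (Fin 10)) := [er, eg, ea, eb, ee1, ee2, ee3, ee4, ee5]

/-- The vertices of H as a list. -/
def verts : List (Fin 10) := [0, 1, 2, 3, 4, 5, 6, 7, 8, 9]

theorem mem_verts : ∀ x : Fin 10, x ∈ verts := by decide

/-- Backtracking search over the images of the edges in the first list; `done` holds the
pairs (edge, image) chosen so far. Branches that violate the pairwise intersection sizes are
pruned; at a leaf every vertex must be pinned to itself by its incidence pattern. -/
def search : List (Finset (Fin 10)) → List (Finset (Fin 10) × Finset (Fin 10)) → Bool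
  | [], done => verts.all fun x => verts.all fun y =>
      !(done.all fun p => decide (x ∈ p.1) == decide (y ∈ p.2)) || decide (y = x)
  | s :: rest, done => edgeList.all fun t =>
      !(done.all fun p => (s ∩ p.1).card == (t ∩ p.2).card) || search rest ((s, t) :: done)

theorem search_sound (φ : Fin 10 → Fin 10) (hφ : Function.Injective φ) :
    ∀ (todo : List (Finset (Fin 10))) (done : List (Finset (Fin 10) × Finset (Fin 10))),
      (∀ s ∈ todo, s.image φ ∈ edgeList) → (∀ p ∈ done, p.1.image φ = p.2) →
      search todo done = true → φ = id := by
  intro todo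
  induction todo with
  | nil =>
    intro done _ hd hs
    rw [search, List.all_eq_true] at hs
    funext x
    have h := List.all_eq_true.1 (hs x (mem_verts x)) (φ x) (mem_verts _)
    have h2 : (done.all fun p => decide (x ∈ p.1) == decide (φ x ∈ p.2)) = true := by
      rw [List.all_eq_true]
      intro p hp
      rw [beq_iff_eq, decide_eq_decide, ← hd p hp, hφ.mem_finset_image]
    rw [h2] at h
    simpa using h
  | cons s rest ih =>
    intro done ht hd hs
    rw [search, List.all_eq_true] at hs
    have h := hs (s.image φ) (ht s (by simp))
    have h2 : (done.all fun p => (s ∩ p.1).card == (s.image φ ∩ p.2).card) = true := by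
      rw [List.all_eq_true]
      intro p hp
      rw [beq_iff_eq, ← hd p hp, ← Finset.image_inter _ _ hφ,
        Finset.card_image_of_injective _ hφ]
    rw [h2] at h
    refine ih _ (fun u hu => ht u (by simp [hu])) ?_ (by simpa using h)
    intro p hp
    rcases List.mem_cons.1 hp with rfl | hp
    · rfl
    · exact hd p hp

theorem search_true : (edgeList.all fun e => search (edgeList.filter fun s => s ≠ e) []) = true := by
  decide +kernel

theorem mem_edgeList (s : Finset (Fin 10)) : s ∈ edgeList ↔ s ∈ Hedges := by
  simp [edgeList, Hedges]

theorem stmt19 (e : Finset (Fin 10)) (he : e ∈ Hedges)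
    (φ : Fin 10 → Fin 10) (hφ : Function.Injective φ)
    (hmono : ∀ s ∈ Hedges \ {e}, s.image φ ∈ Hedges) :
    φ = id := by
  refine search_sound φ hφ _ [] ?_ (by simp) (List.all_eq_true.1 search_true e ((mem_edgeList e).2 he))
  intro s hs
  rw [List.mem_filter] at hs
  rw [mem_edgeList]
  refine hmono s ?_
  rw [Finset.mem_sdiff, Finset.mem_singleton]
  exact ⟨(mem_edgeList s).1 hs.1, by simpa using hs.2⟩
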